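/- Pollard's theorem: Let n be prime and let A, B be nonempty subsets of ℤ_n. For any t ≤ min(|A|, |B|), we have Σ_{i=1}^{t} |A +_i B| ≥ t · min(n, |A| + |B| − t). -/

import Mathlib

/-- `r_{A,B}(x)`: the number of pairs `(a,b) ∈ A × B` with `a + b = x`. -/
def repCount {n : ℕ} (A B : Finset (ZMod n)) (x : ZMod n) : ℕ :=
  ((A ×ˢ B).filter fun p => p.1 + p.2 = x).card

def rr {n : ℕ} (A B : Finset (ZMod n)) (x : ZMod n) : ℕ :=
  ∑ a ∈ A, ∑ b ∈ B, if a + b = x then 1 else 0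

theorem rr_eq {n : ℕ} (A B : Finset (ZMod n)) (x : ZMod n) : repCount A B x = rr A B x := by
  unfold repCount rr
  rw [Finset.card_filter, Finset.sum_product]

theorem rr_comm {n : ℕ} (A B : Finset (ZMod n)) (x : ZMod n) : rr A B x = rr B A x := by
  unfold rr
  rw [Finset.sum_comm]
  simp only [add_comm]

theorem rr_union_left {n : ℕ} (A A' B : Finset (ZMod n)) (h : Disjoint A A') (x : ZMod n) :
    rr (A ∪ A') B x = rr A B x + rr A' B x := by
  unfold rr
  rw [Finset.sum_union h]

theorem rr_union_right {n : ℕ} (A B B' : Finset (ZMod n)) (h : Disjoint B B') (x : ZMod n) :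
    rr A (B ∪ B') x = rr A B x + rr A B' x := by
  rw [rr_comm, rr_union_left _ _ _ h, rr_comm B, rr_comm B']

theorem rr_mono {n : ℕ} (A B B' : Finset (ZMod n)) (h : B' ⊆ B) (x : ZMod n) :
    rr A B' x ≤ rr A B x := by
  rw [← Finset.union_sdiff_of_subset h, rr_union_right _ _ _ Finset.disjoint_sdiff]
  omega

theorem rr_le {n : ℕ} (A B : Finset (ZMod n)) (x : ZMod n) : rr A B x ≤ B.card := by
  rw [rr_comm]
  unfold rr
  rw [Finset.card_eq_sum_ones]
  apply Finset.sum_le_sum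
  intro b _
  have : ∀ a, (b + a = x) = (a = x - b) := by
    intro a
    rw [eq_sub_iff_add_eq, add_comm]
  simp only [this, Finset.sum_ite_eq']
  split_ifs <;> simp

theorem rr_sum {n : ℕ} [NeZero n] (A B : Finset (ZMod n)) :
    ∑ x, rr A B x = A.card * B.card := by
  unfold rr
  rw [Finset.sum_comm]
  have : ∀ a ∈ A, ∑ x : ZMod n, ∑ b ∈ B, (if a + b = x then 1 else 0) = B.card := by
    intro a _
    rw [Finset.sum_comm]
    simp
  rw [Finset.sum_congr rfl this]
  simp

theorem rr_split {n : ℕ} (A B : Finset (ZMod n)) (x : ZMod n) :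
    rr A B x = rr (A ∪ B) (A ∩ B) x + rr (A \ B) (B \ A) x := by
  have hA : A = (A \ B) ∪ (A ∩ B) := (Finset.sdiff_union_inter A B).symm
  have hB : B = (B \ A) ∪ (A ∩ B) := by
    rw [Finset.inter_comm]; exact (Finset.sdiff_union_inter B A).symm
  have hU : A ∪ B = A ∪ (B \ A) := by simp
  have d1 : Disjoint (A \ B) (A ∩ B) := Finset.disjoint_sdiff_inter A B
  have d2 : Disjoint (B \ A) (A ∩ B) := by
    rw [Finset.inter_comm]; exact Finset.disjoint_sdiff_inter B A
  have e1 : rr A B x = rr A (B \ A) x + rr A (A ∩ B) x := by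
    rw [← rr_union_right _ _ _ d2, ← hB]
  have e2 : rr A (B \ A) x = rr (A \ B) (B \ A) x + rr (A ∩ B) (B \ A) x := by
    rw [← rr_union_left _ _ _ d1, ← hA]
  have e3 : rr (A ∪ B) (A ∩ B) x = rr A (A ∩ B) x + rr (B \ A) (A ∩ B) x := by
    rw [hU, rr_union_left _ _ _ Finset.disjoint_sdiff]
  rw [e1, e2, e3, rr_comm (A ∩ B) (B \ A)]
  ring

def SS {n : ℕ} [NeZero n] (t : ℕ) (A B : Finset (ZMod n)) : ℕ := ∑ x, min t (rr A B x)

theorem SS_translate {n : ℕ} [NeZero n] (t : ℕ) (A B : Finset (ZMod n)) (e : ZMod n) :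
    SS t A (B.map (addLeftEmbedding e)) = SS t A B := by
  unfold SS
  rw [← Equiv.sum_comp (Equiv.addLeft e)]
  apply Finset.sum_congr rfl
  intro x _
  congr 1
  unfold rr
  simp only [Finset.sum_map, addLeftEmbedding_apply, Equiv.coe_addLeft, add_left_comm _ e,
    add_right_inj]

theorem exists_tr {n : ℕ} [Fact n.Prime] (A B : Finset (ZMod n)) (hA : A.Nonempty)
    (hB : 1 < B.card) (hA' : A.card < n) :
    ∃ e : ZMod n, (A ∩ B.map (addLeftEmbedding e)).Nonempty ∧
      (A ∩ B.map (addLeftEmbedding e)).card < B.card := by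
  by_contra! hcon
  have key : ∀ e : ZMod n, (A ∩ B.map (addLeftEmbedding e)).Nonempty →
      B.map (addLeftEmbedding e) ⊆ A := by
    intro e he
    have h1 := hcon e he
    have : A ∩ B.map (addLeftEmbedding e) = B.map (addLeftEmbedding e) := by
      apply Finset.eq_of_subset_of_card_le Finset.inter_subset_right
      simpa using h1
    rw [← this]
    exact Finset.inter_subset_left
  obtain ⟨b, hb, b', hb', hne⟩ := Finset.one_lt_card.mp hB
  have hd : b' - b ≠ 0 := sub_ne_zero.mpr hne.symm
  have cl : ∀ a ∈ A, a + (b' - b) ∈ A := by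
    intro a ha
    have := key (a - b) ⟨a, by
      simp only [Finset.mem_inter, Finset.mem_map, addLeftEmbedding_apply]
      exact ⟨ha, b, hb, by ring⟩⟩
    apply this
    simp only [Finset.mem_map, addLeftEmbedding_apply]
    exact ⟨b', hb', by ring⟩
  obtain ⟨a, ha⟩ := hA
  have cl2 : ∀ k : ℕ, a + k * (b' - b) ∈ A := by
    intro k
    induction k with
    | zero => simpa using ha
    | succ k ih =>
      have := cl _ ih
      convert this using 1
      push_cast
      ring
  have : A = Finset.univ := by
    ext x
    simp only [Finset.mem_univ, iff_true]
    have := cl2 ((x - a) / (b' - b)).val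
    rw [ZMod.natCast_zmod_val, div_mul_cancel₀ _ hd] at this
    simpa using this
  rw [this, Finset.card_univ, ZMod.card] at hA'
  omega

theorem pollard {n : ℕ} [Fact n.Prime] (m : ℕ) : ∀ (A B : Finset (ZMod n)) (t : ℕ),
    B.card = m → t ≤ A.card → t ≤ B.card →
    t * min n (A.card + B.card - t) ≤ SS t A B := by
  induction m using Nat.strong_induction_on with
  | _ m IH =>
  intro A B t hm htA htB
  rcases Nat.eq_zero_or_pos t with rfl | ht
  · simp
  rcases Nat.eq_or_lt_of_le htB with h | h
  · have : SS t A B = A.card * B.card := by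
      rw [← rr_sum]
      apply Finset.sum_congr rfl
      intro x _
      have := rr_le A B x
      omega
    rw [this, mul_comm A.card, ← h]
    apply Nat.mul_le_mul_left
    omega
  have hAn : A.card ≤ n := by simpa [ZMod.card] using Finset.card_le_univ A
  by_cases hbig : n < A.card + B.card - t
  · obtain ⟨C, hC, hCc⟩ := Finset.exists_subset_card_eq (s := B) (n := n + t - A.card) (by omega)
    have := IH C.card (by omega) A C t rfl htA (by omega)
    have h2 : SS t A C ≤ SS t A B := by
      apply Finset.sum_le_sum
      intro x _
      have := rr_mono A B C hC x
      omega
    have e1 : min n (A.card + C.card - t) = n := by omega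
    have e2 : min n (A.card + B.card - t) = n := by omega
    rw [e1] at this
    rw [e2]
    omega
  obtain ⟨e, he1, he2⟩ := exists_tr A B (Finset.card_pos.mp (by omega)) (by omega) (by omega)
  rw [← SS_translate t A B e]
  have hc : (B.map (addLeftEmbedding e)).card = B.card := by simp
  rw [← hc] at he2 h hbig htB hm ⊢
  generalize B.map (addLeftEmbedding e) = B at *
  have hUI := Finset.card_union_add_card_inter A B
  have hU : (A ∩ B).card ≤ (A ∪ B).card :=
    Finset.card_le_card (Finset.inter_subset_left.trans Finset.subset_union_left)
  have hpos := Finset.card_pos.mpr he1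
  by_cases hI : t ≤ (A ∩ B).card
  · have := IH (A ∩ B).card (by omega) (A ∪ B) (A ∩ B) t rfl (by omega) hI
    rw [hUI] at this
    refine this.trans (Finset.sum_le_sum ?_)
    intro x _
    have := rr_split A B x
    omega
  · have cA := Finset.card_sdiff_add_card_inter A B
    have cB := Finset.card_sdiff_add_card_inter B A
    rw [Finset.inter_comm B A] at cB
    have := IH (B \ A).card (by omega) (A \ B) (B \ A) (t - (A ∩ B).card) rfl
      (by omega) (by omega)
    have h2 : (A ∪ B).card * (A ∩ B).card + SS (t - (A ∩ B).card) (A \ B) (B \ A) ≤ SS t A B := by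
      rw [← rr_sum]
      unfold SS
      rw [← Finset.sum_add_distrib]
      apply Finset.sum_le_sum
      intro x _
      have := rr_split A B x
      have := rr_le (A ∪ B) (A ∩ B) x
      omega
    rw [min_eq_right (by omega)] at this ⊢
    refine le_trans ?_ ((Nat.add_le_add_left this _).trans h2)
    generalize (A ∩ B).card = i at *
    generalize (A ∪ B).card = u at *
    generalize (A \ B).card = a at *
    generalize (B \ A).card = b at *
    obtain ⟨k, rfl⟩ : ∃ k, t = i + k := ⟨t - i, by omega⟩
    obtain ⟨l, rfl⟩ : ∃ l, b = k + l := ⟨b - k, by omega⟩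
    have e1 : A.card + B.card - (i + k) = a + l + i := by omega
    have e2 : a + (k + l) - (i + k - i) = a + l := by omega
    have e3 : u = a + k + l + i := by omega
    have e4 : i + k - i = k := by omega
    rw [e1, e2, e3, e4]
    apply le_of_eq
    ring

theorem stmt10 (n : ℕ) (hn : n.Prime) (A B : Finset (ZMod n))
    (hA : A.Nonempty) (hB : B.Nonempty) (t : ℕ) (ht : t ≤ min A.card B.card) :
    t * min n (A.card + B.card - t) ≤
      ∑ i ∈ Finset.Icc 1 t, {x : ZMod n | i ≤ repCount A B x}.ncard := by
  haveI : Fact n.Prime := ⟨hn⟩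
  refine (pollard B.card A B t rfl (by omega) (by omega)).trans (le_of_eq ?_)
  have h1 : ∀ i ∈ Finset.Icc 1 t, {x : ZMod n | i ≤ repCount A B x}.ncard
      = ∑ x : ZMod n, if i ≤ rr A B x then 1 else 0 := by
    intro i _
    rw [← Finset.card_filter, ← Set.ncard_coe_finset]
    congr 1
    ext x
    simp [rr_eq]
  rw [Finset.sum_congr rfl h1, Finset.sum_comm]
  unfold SS
  apply Finset.sum_congr rfl
  intro x _
  rw [← Finset.card_filter]
  have : (Finset.Icc 1 t).filter (fun i => i ≤ rr A B x) = Finset.Icc 1 (min t (rr A B x)) := by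
    ext i
    simp only [Finset.mem_filter, Finset.mem_Icc]
    omega
  rw [this]
  simp
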